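/- arXiv:2106.02500 — 3 statements merged into one kernel-verified Lean document; each statement's English description precedes it below -/
import Mathlib

section
/- Let n, δ ∈ ℕ with δ ≥ 3 and n ≥ 6. If G is a connected, C₄-free graph of order n and minimum degree δ, then diam(G) − π(G) ≤ 15n/(4(δ² − 2⌊δ/2⌋ + 1)) + 7/4. -/
namespace SimpleGraph

theorem Connected.exists_dist_eq_of_le {V : Type*} {G : SimpleGraph V} (hconn : G.Connected)
    (a b : V) {i : ℕ} (hi : i ≤ G.dist a b) : ∃ c, G.dist a c = i := by
  obtain ⟨p, hp⟩ := hconn.exists_walk_length_eq_dist a b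
  refine ⟨p.getVert i, ?_⟩
  have h1 := dist_le (p.take i)
  have h2 := dist_le (p.drop i)
  have h3 := hconn.dist_triangle (u := a) (v := p.getVert i) (w := b)
  rw [Walk.take_length] at h1
  rw [Walk.drop_length] at h2
  omega

variable {V : Type*} [Fintype V] [DecidableEq V] (G : SimpleGraph V) [DecidableRel G.Adj]

/-- In a `C₄`-free graph every vertex has at least `δ² - 2⌊δ/2⌋ + 1` vertices within distance two. -/
theorem le_card_ball_two_of_c4_free (hconn : G.Connected) (h3 : 3 ≤ G.minDegree)
    (hc4 : ∀ a b c d : V, G.Adj a b → G.Adj b c → G.Adj c d → G.Adj d a → a ≠ c → b ≠ d → False)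
    (v : V) :
    G.minDegree ^ 2 - 2 * (G.minDegree / 2) + 1 ≤
      (Finset.univ.filter fun w => G.dist v w ≤ 2).card := by
  classical
  let N := G.neighborFinset v
  let S : V → Finset V := fun u => G.neighborFinset u \ insert v N
  let e : V → ℕ := fun u => (G.neighborFinset u ∩ N).card
  have he : ∀ u ∈ N, e u ≤ 1 := by
    intro u hu
    refine Finset.card_le_one.2 fun a ha b hb => ?_
    simp only [N, Finset.mem_inter, mem_neighborFinset] at ha hb hu
    by_contra hab
    exact hc4 v a u b ha.2 ha.1.symm hb.1 hb.2.symm hu.ne hab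
  have hS : ∀ u ∈ N, G.minDegree ≤ (S u).card + 1 + e u := by
    intro u hu
    have h1 : (G.neighborFinset u).card ≤ (S u ∪ {v} ∪ (G.neighborFinset u ∩ N)).card := by
      refine Finset.card_le_card fun w hw => ?_
      simp only [S, Finset.mem_union, Finset.mem_sdiff, Finset.mem_insert, Finset.mem_inter,
        Finset.mem_singleton]
      tauto
    have h2 := Finset.card_union_le (S u ∪ {v}) (G.neighborFinset u ∩ N)
    have h3 := Finset.card_union_le (S u) {v}
    have h4 := G.minDegree_le_degree u
    rw [Finset.card_singleton] at h3
    rw [card_neighborFinset_eq_degree] at h1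
    simp only [e]
    omega
  have heven : Even (∑ u ∈ N, e u) := by
    let H : SimpleGraph V :=
      { Adj := fun a b => G.Adj a b ∧ G.Adj v a ∧ G.Adj v b
        symm := ⟨fun a b h => ⟨h.1.symm, h.2.2, h.2.1⟩⟩
        loopless := ⟨fun a h => G.loopless.irrefl a h.1⟩ }
    have h1 : ∑ u ∈ N, e u = ∑ u, H.degree u := by
      rw [← Finset.sum_subset (Finset.subset_univ N)]
      · refine Finset.sum_congr rfl fun u hu => ?_
        rw [← card_neighborFinset_eq_degree]
        change (G.neighborFinset u ∩ N).card = (H.neighborFinset u).card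
        congr 1
        ext w
        simp only [N, mem_neighborFinset] at hu
        simp [N, H, hu]
      · intro u _ hu
        rw [← card_neighborFinset_eq_degree, Finset.card_eq_zero]
        ext w
        simp only [N, mem_neighborFinset] at hu
        simp [H, hu]
    rw [h1, sum_degrees_eq_twice_card_edges]
    exact even_two_mul _
  have hsum : ∑ u ∈ N, e u ≤ N.card := by
    simpa using Finset.sum_le_card_nsmul N e 1 he
  have hdisj : (N : Set V).PairwiseDisjoint S := by
    intro a ha b hb hab
    refine Finset.disjoint_left.2 fun w hwa hwb => ?_
    simp only [S, N, Finset.mem_sdiff, mem_neighborFinset, Finset.mem_insert, Finset.mem_coe,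
      not_or] at hwa hwb ha hb
    exact hc4 v a w b ha hwa.1 hwb.1.symm hb.symm (Ne.symm hwa.2.1) hab
  have hdisj' : Disjoint (insert v N) (N.biUnion S) := by
    refine Finset.disjoint_left.2 fun w hw hw' => ?_
    obtain ⟨u, -, hu⟩ := Finset.mem_biUnion.1 hw'
    exact (Finset.mem_sdiff.1 hu).2 hw
  have hsub : insert v N ∪ N.biUnion S ⊆ Finset.univ.filter fun w => G.dist v w ≤ 2 := by
    intro w hw
    simp only [S, N, Finset.mem_union, Finset.mem_insert, Finset.mem_biUnion, Finset.mem_sdiff,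
      mem_neighborFinset] at hw
    simp only [Finset.mem_filter, Finset.mem_univ, true_and]
    rcases hw with (rfl | h) | ⟨u, hu, hw, -⟩
    · simp
    · rw [dist_eq_one_iff_adj.2 h]; norm_num
    · have := hconn.dist_triangle (u := v) (v := u) (w := w)
      rw [dist_eq_one_iff_adj.2 hu, dist_eq_one_iff_adj.2 hw] at this
      exact this
  have hcard := Finset.card_le_card hsub
  rw [Finset.card_union_of_disjoint hdisj', Finset.card_biUnion hdisj,
    Finset.card_insert_of_notMem (by simp [N])] at hcard
  have htot : N.card * G.minDegree ≤ ∑ u ∈ N, (S u).card + N.card + ∑ u ∈ N, e u := by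
    have := Finset.sum_le_sum hS
    simpa [Finset.sum_add_distrib] using this
  have hdeg : G.minDegree ≤ N.card := by
    simpa [N] using G.minDegree_le_degree v
  obtain ⟨m, hm⟩ := heven
  obtain ⟨t, ht⟩ := Nat.exists_eq_add_of_le hdeg
  have hmul : N.card * G.minDegree = G.minDegree ^ 2 + t * G.minDegree := by rw [ht]; ring
  have ht3 : t * 3 ≤ t * G.minDegree := Nat.mul_le_mul_left t h3
  omega

end SimpleGraph

/-- If points are spaced five apart, then the distances to them sum to at least `5 (K² - 1) / 4`. -/
theorem sum_range_ge_of_add_reflect_ge (g : ℕ → ℝ) (K : ℕ) (h0 : ∀ j, 0 ≤ g j)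
    (hg : ∀ i j, i < j → j < K → 5 * ((j : ℝ) - i) ≤ g i + g j) :
    5 * ((K : ℝ) ^ 2 - 1) / 4 ≤ ∑ j ∈ Finset.range K, g j := by
  induction K using Nat.strong_induction_on generalizing g with
  | _ K ih =>
    match K with
    | 0 => norm_num
    | 1 => simpa using h0 0
    | K + 2 =>
      have h := ih K (by omega) (fun j => g (j + 1)) (fun j => h0 _) fun i j hij hj => by
        have := hg (i + 1) (j + 1) (by omega) (by omega)
        push_cast at this
        linarith
      have h' := hg 0 (K + 1) (by omega) (by omega)
      rw [Finset.sum_range_succ, Finset.sum_range_succ']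
      push_cast at h' ⊢
      linarith


theorem stmt14 {V : Type*} [Fintype V] [DecidableEq V] (G : SimpleGraph V)
    [DecidableRel G.Adj] (n δ : ℕ) (hn : Fintype.card V = n) (hδ : G.minDegree = δ) (hconn : G.Connected) (h3 : 3 ≤ δ) (h6 : 6 ≤ n) (hc4 : (∀ a b c d : V, G.Adj a b → G.Adj b c → G.Adj c d → G.Adj d a → a ≠ c → b ≠ d → False)) :
    (((Finset.univ.sup fun v : V => Finset.univ.sup fun w : V => G.dist v w) : ℕ) : ℝ) - (⨅ v : V, (∑ w : V, (G.dist v w : ℝ)) / ((n : ℝ) - 1)) ≤ 15 * (n : ℝ) / (4 * ((δ ^ 2 - 2 * (δ / 2) + 1 : ℕ) : ℝ)) + 7 / 4 := by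
  have hne : Nonempty V := hconn.nonempty
  set M : ℕ := δ ^ 2 - 2 * (δ / 2) + 1 with hM
  obtain ⟨v₀, -, hv₀⟩ := Finset.exists_mem_eq_sup Finset.univ Finset.univ_nonempty
    (fun v : V => Finset.univ.sup fun w : V => G.dist v w)
  obtain ⟨w₀, -, hw₀⟩ := Finset.exists_mem_eq_sup Finset.univ Finset.univ_nonempty
    (fun w : V => G.dist v₀ w)
  rw [hv₀, hw₀]
  set d := G.dist v₀ w₀ with hd
  set K := d / 5 + 1 with hK
  have hf : ∀ j, ∃ c, j < K → G.dist v₀ c = 5 * j := by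
    intro j
    by_cases hj : j < K
    · obtain ⟨c, hc⟩ := hconn.exists_dist_eq_of_le v₀ w₀ (i := 5 * j) (by omega)
      exact ⟨c, fun _ => hc⟩
    · exact ⟨v₀, fun h => absurd h hj⟩
  choose f hf using hf
  let B : ℕ → Finset V := fun j => Finset.univ.filter fun w => G.dist (f j) w ≤ 2
  have hB : ∀ j, M ≤ (B j).card := fun j => by
    subst hδ
    exact G.le_card_ball_two_of_c4_free hconn h3 hc4 (f j)
  have hsep : ∀ i j, i < K → j < K → ∀ w, 5 * j ≤ 5 * i + (G.dist (f i) w + G.dist (f j) w) := by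
    intro i j hi hj w
    have h1 := hconn.dist_triangle (u := v₀) (v := f i) (w := f j)
    have h2 := hconn.dist_triangle (u := f i) (v := w) (w := f j)
    rw [hf i hi, hf j hj] at h1
    rw [G.dist_comm (u := w)] at h2
    omega
  have hdisj : ((Finset.range K : Finset ℕ) : Set ℕ).PairwiseDisjoint B := by
    intro i hi j hj hij
    simp only [Finset.coe_range, Set.mem_Iio] at hi hj
    refine Finset.disjoint_left.2 fun w hwi hwj => ?_
    simp only [B, Finset.mem_filter, Finset.mem_univ, true_and] at hwi hwj
    have h1 := hsep i j hi hj w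
    have h2 := hsep j i hj hi w
    omega
  have hnK : K * M ≤ n := by
    have h1 := Finset.card_le_univ ((Finset.range K).biUnion B)
    rw [Finset.card_biUnion hdisj, hn] at h1
    have h2 := Finset.card_nsmul_le_sum (Finset.range K) (fun j => (B j).card) M fun j _ => hB j
    simp only [Finset.card_range, smul_eq_mul] at h2
    exact h2.trans h1
  have hM0 : (0 : ℝ) < M := by exact_mod_cast Nat.succ_pos _
  have hn6 : (6 : ℝ) ≤ n := by exact_mod_cast h6
  have hdK : (d : ℝ) ≤ 5 * K - 1 := by
    have : d + 1 ≤ 5 * K := by omega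
    have : (d : ℝ) + 1 ≤ 5 * K := by exact_mod_cast this
    linarith
  have hnK' : (K : ℝ) * M ≤ n := by exact_mod_cast hnK
  have hK1 : (1 : ℝ) ≤ K := by exact_mod_cast Nat.succ_pos _
  have key : ∀ v : V, (M : ℝ) * (5 * ((K : ℝ) ^ 2 - 1) / 4 - 2 * K) ≤ ∑ w, (G.dist v w : ℝ) := by
    intro v
    have hsum := sum_range_ge_of_add_reflect_ge (fun j => (G.dist (f j) v : ℝ)) K
      (fun j => by positivity) fun i j hij hj => by
        have : (5 * j : ℝ) ≤ 5 * i + (G.dist (f i) v + G.dist (f j) v) := by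
          exact_mod_cast hsep i j (hij.trans hj) hj v
        linarith
    have hball : ∀ j, (M : ℝ) * ((G.dist (f j) v : ℝ) - 2) ≤ ∑ w ∈ B j, (G.dist v w : ℝ) := by
      intro j
      rcases le_total (G.dist (f j) v : ℝ) 2 with h | h
      · exact (mul_nonpos_of_nonneg_of_nonpos hM0.le (by linarith)).trans
          (Finset.sum_nonneg fun _ _ => by positivity)
      · have h1 := Finset.card_nsmul_le_sum (B j) (fun w => (G.dist v w : ℝ))
          ((G.dist (f j) v : ℝ) - 2) fun w hw => by
            simp only [B, Finset.mem_filter, Finset.mem_univ, true_and] at hw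
            have h2 := hconn.dist_triangle (u := f j) (v := w) (w := v)
            rw [G.dist_comm (u := w)] at h2
            have : G.dist (f j) v ≤ G.dist v w + 2 := by omega
            have : (G.dist (f j) v : ℝ) ≤ G.dist v w + 2 := by exact_mod_cast this
            linarith
        rw [nsmul_eq_mul] at h1
        refine le_trans (mul_le_mul_of_nonneg_right ?_ (by linarith)) h1
        exact_mod_cast hB j
    calc (M : ℝ) * (5 * ((K : ℝ) ^ 2 - 1) / 4 - 2 * K)
        ≤ M * (∑ j ∈ Finset.range K, ((G.dist (f j) v : ℝ) - 2)) := by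
          refine mul_le_mul_of_nonneg_left ?_ hM0.le
          rw [Finset.sum_sub_distrib]
          simp only [Finset.sum_const, Finset.card_range, nsmul_eq_mul]
          linarith
      _ ≤ ∑ j ∈ Finset.range K, ∑ w ∈ B j, (G.dist v w : ℝ) := by
          rw [Finset.mul_sum]
          exact Finset.sum_le_sum fun j _ => hball j
      _ = ∑ w ∈ (Finset.range K).biUnion B, (G.dist v w : ℝ) := (Finset.sum_biUnion hdisj).symm
      _ ≤ ∑ w, (G.dist v w : ℝ) :=
          Finset.sum_le_sum_of_subset_of_nonneg (Finset.subset_univ _) fun _ _ _ => by positivity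
  rw [sub_le_comm]
  refine le_ciInf fun v => ?_
  have hσ : 0 ≤ ∑ w, (G.dist v w : ℝ) := Finset.sum_nonneg fun _ _ => by positivity
  have hdiv : (∑ w, (G.dist v w : ℝ)) / n ≤ (∑ w, (G.dist v w : ℝ)) / ((n : ℝ) - 1) :=
    div_le_div_of_nonneg_left hσ (by linarith) (by linarith)
  refine le_trans ?_ hdiv
  have hv := key v
  obtain ⟨N, hN⟩ : ∃ N : ℝ, (n : ℝ) = N * M := ⟨n / M, by field_simp⟩
  have hNK : (K : ℝ) ≤ N := by
    rw [hN] at hnK'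
    exact le_of_mul_le_mul_right hnK' hM0
  have hN0 : 0 < N := by linarith
  have hbound : 15 * (n : ℝ) / (4 * (M : ℝ)) = 15 * N / 4 := by
    rw [hN]; field_simp
  rw [hbound]
  rcases Nat.lt_or_ge 1 K with hK2 | hK2
  · have hK2' : (2 : ℝ) ≤ K := by exact_mod_cast hK2
    have h1 : (5 * ((K : ℝ) ^ 2 - 1) / 4 - 2 * K) / N ≤ (∑ w, (G.dist v w : ℝ)) / n := by
      rw [hN, div_le_div_iff₀ hN0 (by positivity)]
      nlinarith
    refine le_trans ?_ h1
    rw [le_div_iff₀ hN0]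
    nlinarith [mul_nonneg (sub_nonneg.2 hNK) (sub_nonneg.2 hNK), mul_nonneg (sub_nonneg.2 hNK)
      (sub_nonneg.2 hK2'), mul_nonneg (sub_nonneg.2 hdK) hN0.le]
  · have : (K : ℝ) ≤ 1 := by exact_mod_cast hK2
    have : 0 ≤ (∑ w, (G.dist v w : ℝ)) / n := div_nonneg hσ (by positivity)
    linarith
end

section
/- Let n, δ ∈ ℕ with δ ≥ 3 and n ≥ 6. If G is a connected, triangle-free graph of order n and minimum degree δ, then rad(G) − π(G) ≤ (n−1)/(2δ) + 11/2. -/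
/-- A shortest path between two vertices, as a sequence of vertices. -/
theorem SimpleGraph.Connected.exists_geodesic {V : Type*} {G : SimpleGraph V}
    (hconn : G.Connected) (v u : V) :
    ∃ x : ℕ → V, x (G.dist v u) = u ∧ (∀ i ≤ G.dist v u, G.dist v (x i) = i) ∧
      ∀ i j, i ≤ j → j ≤ G.dist v u → i + G.dist (x i) (x j) ≤ j := by
  obtain ⟨p, hp⟩ := hconn.exists_walk_length_eq_dist v u
  have step : ∀ i j, i ≤ j → j ≤ G.dist v u →
      i + G.dist (p.getVert i) (p.getVert j) ≤ j := by
    intro i j hij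
    induction j, hij using Nat.le_induction with
    | base => simp
    | succ j hij ih =>
      intro hj
      have h1 := ih (by omega)
      have h2 : G.Adj (p.getVert j) (p.getVert (j + 1)) :=
        p.adj_getVert_succ (by omega)
      have h3 := hconn.dist_triangle (u := p.getVert i) (v := p.getVert j)
        (w := p.getVert (j + 1))
      have h4 := SimpleGraph.dist_eq_one_iff_adj.2 h2
      omega
  have hend : p.getVert (G.dist v u) = u := by rw [← hp]; exact p.getVert_length
  refine ⟨p.getVert, hend, fun i hi => ?_, step⟩
  have h1 := step 0 i (by omega) hi
  have h2 := step i _ hi le_rfl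
  have h3 := hconn.dist_triangle (u := v) (v := p.getVert i) (w := u)
  rw [hend] at h2
  simp only [SimpleGraph.Walk.getVert_zero] at h1
  omega

/-- In a triangle-free graph a vertex has at most two neighbours on a geodesic. -/
theorem SimpleGraph.card_filter_adj_geodesic_le_two {V : Type*} {G : SimpleGraph V}
    [DecidableRel G.Adj] (hconn : G.Connected) (htf : G.CliqueFree 3) {v : V} {x : ℕ → V}
    {e : ℕ} (hx : ∀ i ≤ e, G.dist v (x i) = i)
    (hxx : ∀ i j, i ≤ j → j ≤ e → i + G.dist (x i) (x j) ≤ j)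
    (s : Finset ℕ) (hs : ∀ i ∈ s, i ≤ e) (w : V) :
    (s.filter fun i => G.Adj w (x i)).card ≤ 2 := by
  classical
  have hnear : ∀ i ∈ s, G.Adj w (x i) → i ≤ G.dist v w + 1 ∧ G.dist v w ≤ i + 1 := by
    intro i hi hw
    have h1 := SimpleGraph.dist_eq_one_iff_adj.2 hw
    have h2 := SimpleGraph.dist_eq_one_iff_adj.2 hw.symm
    have h3 := hconn.dist_triangle (u := v) (v := w) (w := x i)
    have h4 := hconn.dist_triangle (u := v) (v := x i) (w := w)
    have h5 := hx i (hs i hi)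
    omega
  have hconsec : ∀ i, i + 1 ≤ e → G.Adj w (x i) → G.Adj w (x (i + 1)) → False := by
    intro i hi h1 h2
    have hne : x i ≠ x (i + 1) := by
      intro h
      have h3 := hx i (by omega)
      have h4 := hx (i + 1) hi
      rw [h] at h3
      omega
    have h3 := hxx i (i + 1) (by omega) hi
    have h4 := hconn.pos_dist_of_ne hne
    have h5 : G.Adj (x i) (x (i + 1)) := SimpleGraph.dist_eq_one_iff_adj.1 (by omega)
    exact htf {w, x i, x (i + 1)} (SimpleGraph.is3Clique_triple_iff.2 ⟨h1, h2, h5⟩)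
  by_cases hd : G.dist v w ∈ s.filter fun i => G.Adj w (x i)
  · refine (Finset.card_le_card (t := {G.dist v w}) ?_).trans (by simp)
    intro i hi
    rw [Finset.mem_filter] at hi hd
    have h1 := hnear i hi.1 hi.2
    rw [Finset.mem_singleton]
    by_contra hne
    rcases (by omega : i = G.dist v w + 1 ∨ G.dist v w = i + 1) with h | h
    · rw [h] at hi
      exact hconsec _ (hs _ hi.1) hd.2 hi.2
    · rw [h] at hd
      exact hconsec _ (hs _ hd.1) hi.2 hd.2
  · refine (Finset.card_le_card (t := {G.dist v w - 1, G.dist v w + 1}) ?_).trans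
      Finset.card_le_two
    intro i hi
    have hne : i ≠ G.dist v w := by rintro rfl; exact hd hi
    rw [Finset.mem_filter] at hi
    have h1 := hnear i hi.1 hi.2
    simp only [Finset.mem_insert, Finset.mem_singleton]
    omega

/-- The neighbours of the vertices `x i` contribute at least `δ * (i - 1)` each to the sum of
distances from `v`, weighted by multiplicity. -/
theorem SimpleGraph.mul_sum_sub_one_le_sum_dist_mul_card {V : Type*} [Fintype V]
    {G : SimpleGraph V} [DecidableRel G.Adj] (hconn : G.Connected) {v : V} {x : ℕ → V}
    (s : Finset ℕ) (hx : ∀ i ∈ s, G.dist v (x i) = i) :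
    G.minDegree * ∑ i ∈ s, (i - 1) ≤
      ∑ w, G.dist v w * (s.filter fun i => G.Adj w (x i)).card := by
  simp_rw [Finset.card_filter, Finset.mul_sum]
  rw [Finset.sum_comm]
  refine Finset.sum_le_sum fun i hi => ?_
  simp only [mul_ite, mul_one, mul_zero]
  rw [← Finset.sum_filter]
  have hfilter : (Finset.univ.filter fun w => G.Adj w (x i)) = G.neighborFinset (x i) := by
    ext w
    simp [SimpleGraph.adj_comm]
  rw [hfilter]
  calc G.minDegree * (i - 1) ≤ (G.neighborFinset (x i)).card * (i - 1) :=
        Nat.mul_le_mul_right _ (by simpa using G.minDegree_le_degree (x i))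
    _ ≤ ∑ w ∈ G.neighborFinset (x i), G.dist v w := by
        rw [← smul_eq_mul]
        refine Finset.card_nsmul_le_sum _ _ _ fun w hw => ?_
        rw [SimpleGraph.mem_neighborFinset] at hw
        have h1 := SimpleGraph.dist_eq_one_iff_adj.2 hw.symm
        have h2 := hconn.dist_triangle (u := v) (v := w) (w := x i)
        have h3 := hx i hi
        omega

theorem sum_Ico_sub_one_lower_bound (k m : ℕ) (hk : 1 ≤ k) :
    (m : ℤ) * (m - 1) ≤
      2 * ((∑ i ∈ Finset.Ico k (m + 1), (i - 1) : ℕ) : ℤ) + (k - 1) * (k - 2) := by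
  have hk' : (1 : ℤ) ≤ k := by exact_mod_cast hk
  by_cases hkm : k ≤ m + 1
  · induction m with
    | zero =>
      obtain rfl : k = 1 := by omega
      simp
    | succ m ih =>
      by_cases h : k ≤ m + 1
      · rw [Finset.sum_Ico_succ_top h]
        have := ih h
        push_cast [Nat.add_sub_cancel] at this ⊢
        linarith
      · obtain rfl : k = m + 2 := by omega
        simp
        nlinarith
  · rw [Finset.Ico_eq_empty (by omega)]
    have : (m : ℤ) + 2 ≤ k := by exact_mod_cast (by omega : m + 2 ≤ k)
    simp
    nlinarith

/-- A lower bound for the sum of distances from a vertex in a triangle-free graph whose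
eccentricities are all at least `r`. -/
theorem SimpleGraph.minDegree_mul_le_sum_dist {V : Type*} [Fintype V]
    {G : SimpleGraph V} [DecidableRel G.Adj] (hconn : G.Connected) (htf : G.CliqueFree 3)
    {r : ℕ} (hr : 6 ≤ r) (hecc : ∀ u, ∃ w, r ≤ G.dist u w) (v : V) :
    (G.minDegree : ℝ) * (r - 11 / 2) ^ 2 ≤ 2 * ∑ w, (G.dist v w : ℝ) := by
  have : Nonempty V := ⟨v⟩
  obtain ⟨u, hu⟩ := Finite.exists_max (G.dist v)
  obtain ⟨x, -, hx, hxx⟩ := hconn.exists_geodesic v u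
  set e := G.dist v u with he
  have hre : r ≤ e := by
    obtain ⟨w, hw⟩ := hecc v
    exact hw.trans (hu w)
  obtain ⟨t, ht⟩ := Nat.exists_eq_add_of_le hre
  obtain ⟨z, hz⟩ := hecc (x (t + 5))
  obtain ⟨y, hyz, hy, hyy⟩ := hconn.exists_geodesic v z
  have hme : G.dist v z ≤ e := hu z
  set m := G.dist v z with hm
  have hrm : r ≤ m + t + 5 := by
    have h1 := hconn.dist_triangle (u := x (t + 5)) (v := v) (w := z)
    have h2 := hx (t + 5) (by omega)
    rw [SimpleGraph.dist_comm] at h2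
    omega
  have hfar : ∀ w i k, i ≤ e → t + 5 ≤ k → k ≤ m → G.Adj w (x i) → G.Adj w (y k) →
      False := by
    intro w i k hi hk hkm h1 h2
    have d1 := SimpleGraph.dist_eq_one_iff_adj.2 h1.symm
    have d2 := SimpleGraph.dist_eq_one_iff_adj.2 h2
    have d3 := hconn.dist_triangle (u := x i) (v := w) (w := y k)
    have d4 := hyy k m hkm le_rfl
    rw [hyz] at d4
    have d5 := hconn.dist_triangle (u := x i) (v := y k) (w := z)
    have d6 := hconn.dist_triangle (u := x (t + 5)) (v := x i) (w := z)
    have d7 := hconn.dist_triangle (u := v) (v := x i) (w := y k)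
    have d8 := hconn.dist_triangle (u := v) (v := y k) (w := x i)
    have d9 := hx i hi
    have d10 := hy k hkm
    have d11 : G.dist (y k) (x i) = G.dist (x i) (y k) := SimpleGraph.dist_comm
    rcases le_total (t + 5) i with h | h
    · have := hxx _ _ h hi
      omega
    · have := hxx _ _ h (by omega)
      rw [SimpleGraph.dist_comm] at this
      omega
  have hX := G.mul_sum_sub_one_le_sum_dist_mul_card hconn (v := v) (x := x)
    (Finset.Ico 1 (e + 1)) (fun i hi => hx i (by simp at hi; omega))
  have hY := G.mul_sum_sub_one_le_sum_dist_mul_card hconn (v := v) (x := y)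
    (Finset.Ico (t + 5) (m + 1)) (fun i hi => hy i (by simp at hi; omega))
  have hXY : G.minDegree * (∑ i ∈ Finset.Ico 1 (e + 1), (i - 1) +
      ∑ i ∈ Finset.Ico (t + 5) (m + 1), (i - 1)) ≤ 2 * ∑ w, G.dist v w := by
    rw [mul_add]
    refine (add_le_add hX hY).trans ?_
    rw [← Finset.sum_add_distrib, Finset.mul_sum]
    refine Finset.sum_le_sum fun w _ => ?_
    rw [← mul_add, mul_comm]
    refine Nat.mul_le_mul_right _ ?_
    have c1 := G.card_filter_adj_geodesic_le_two hconn htf hx hxx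
      (Finset.Ico 1 (e + 1)) (fun i hi => by simp at hi; omega) w
    have c2 := G.card_filter_adj_geodesic_le_two hconn htf hy hyy
      (Finset.Ico (t + 5) (m + 1)) (fun i hi => by simp at hi; omega) w
    rcases Finset.eq_empty_or_nonempty
      ((Finset.Ico 1 (e + 1)).filter fun i => G.Adj w (x i)) with h | ⟨i, hi⟩
    · rw [h]
      simpa using c2
    · rcases Finset.eq_empty_or_nonempty
        ((Finset.Ico (t + 5) (m + 1)).filter fun i => G.Adj w (y i)) with h | ⟨k, hk⟩
      · rw [h]
        simpa using c1
      · simp only [Finset.mem_filter, Finset.mem_Ico] at hi hk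
        exact (hfar w i k (by omega) (by omega) (by omega) hi.2 hk.2).elim
  have sX := sum_Ico_sub_one_lower_bound 1 e le_rfl
  have sY := sum_Ico_sub_one_lower_bound (t + 5) m (by omega)
  set a := ∑ i ∈ Finset.Ico 1 (e + 1), (i - 1)
  set b := ∑ i ∈ Finset.Ico (t + 5) (m + 1), (i - 1)
  have hsum : 2 * ((r : ℝ) - 11 / 2) ^ 2 ≤ 2 * (a + b) := by
    have key : 4 * (r : ℤ) ^ 2 - 44 * r + 121 ≤ 4 * (a + b) := by
      have hr' : (6 : ℤ) ≤ r := by exact_mod_cast hr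
      have ht0 : (0 : ℤ) ≤ t := by positivity
      have hb0 : (0 : ℤ) ≤ b := by positivity
      have hb : (r : ℤ) ^ 2 - 2 * r * t - 11 * r + 4 * t + 18 ≤ 2 * b := by
        rcases le_total r (t + 5) with h | h
        · have h' : (r : ℤ) ≤ t + 5 := by exact_mod_cast h
          nlinarith
        · have h' : (t : ℤ) + 5 ≤ r := by exact_mod_cast h
          obtain ⟨q, hq⟩ := Nat.exists_eq_add_of_le h
          have hqm : q ≤ m := by omega
          have hmono : (q : ℤ) * (q - 1) ≤ m * (m - 1) := by
            rcases Nat.eq_zero_or_pos m with h0 | h0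
            · obtain rfl : q = 0 := by omega
              simp [h0]
            · have h1 : (q : ℤ) ≤ m := by exact_mod_cast hqm
              have h2 : (1 : ℤ) ≤ m := by exact_mod_cast h0
              nlinarith
          have hq' : (q : ℤ) = r - t - 5 := by rw [hq]; push_cast; ring
          rw [hq'] at hmono
          push_cast at sY
          nlinarith
      have he' : (e : ℤ) = r + t := by exact_mod_cast ht
      rw [he'] at sX
      push_cast at sX
      nlinarith
    have key' : 4 * (r : ℝ) ^ 2 - 44 * r + 121 ≤ 4 * (a + b) := by exact_mod_cast key
    nlinarith
  have hXY' : (G.minDegree : ℝ) * (a + b) ≤ 2 * ∑ w, (G.dist v w : ℝ) := by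
    exact_mod_cast hXY
  refine le_trans ?_ hXY'
  exact mul_le_mul_of_nonneg_left (by linarith) (Nat.cast_nonneg _)

theorem stmt16 {V : Type*} [Fintype V] [DecidableEq V] (G : SimpleGraph V)
    [DecidableRel G.Adj] (n δ : ℕ) (hn : Fintype.card V = n) (hδ : G.minDegree = δ) (hconn : G.Connected) (h3 : 3 ≤ δ) (h6 : 6 ≤ n) (htf : G.CliqueFree 3) :
    (((⨅ v : V, Finset.univ.sup fun w : V => G.dist v w) : ℕ) : ℝ) - (⨅ v : V, (∑ w : V, (G.dist v w : ℝ)) / ((n : ℝ) - 1)) ≤ ((n : ℝ) - 1) / (2 * (δ : ℝ)) + 11 / 2 := by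
  have : Nonempty V := hconn.nonempty
  set r := ⨅ v : V, Finset.univ.sup fun w : V => G.dist v w with hr
  have hecc : ∀ u, ∃ w, r ≤ G.dist u w := by
    intro u
    obtain ⟨w, -, hw⟩ := Finset.exists_mem_eq_sup Finset.univ Finset.univ_nonempty
      (fun w : V => G.dist u w)
    exact ⟨w, hw ▸ ciInf_le (OrderBot.bddBelow _) u⟩
  have hN : (0 : ℝ) < (n : ℝ) - 1 := by
    have : (6 : ℝ) ≤ n := by exact_mod_cast h6
    linarith
  have hδ0 : (0 : ℝ) < δ := by
    have : (3 : ℝ) ≤ δ := by exact_mod_cast h3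
    linarith
  rw [sub_le_comm]
  refine le_ciInf fun v => ?_
  rcases Nat.lt_or_ge r 6 with h | h
  · have h1 : (r : ℝ) ≤ 5 := by exact_mod_cast (by omega : r ≤ 5)
    have h2 : 0 ≤ ((n : ℝ) - 1) / (2 * (δ : ℝ)) := by positivity
    have h3 : 0 ≤ (∑ w : V, (G.dist v w : ℝ)) / ((n : ℝ) - 1) := by positivity
    linarith
  · have hσ := G.minDegree_mul_le_sum_dist hconn htf h hecc v
    rw [hδ] at hσ
    have h1 : (δ : ℝ) * (r - 11 / 2) ^ 2 / 2 / ((n : ℝ) - 1) ≤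
        (∑ w : V, (G.dist v w : ℝ)) / ((n : ℝ) - 1) := by
      gcongr
      linarith
    have h2 : (r : ℝ) - 11 / 2 ≤
        (δ : ℝ) * (r - 11 / 2) ^ 2 / 2 / ((n : ℝ) - 1) + ((n : ℝ) - 1) / (2 * (δ : ℝ)) := by
      rw [← sub_nonneg]
      have : (δ : ℝ) * (r - 11 / 2) ^ 2 / 2 / ((n : ℝ) - 1) + ((n : ℝ) - 1) / (2 * (δ : ℝ)) -
          ((r : ℝ) - 11 / 2) =
          (δ * (r - 11 / 2) - ((n : ℝ) - 1)) ^ 2 / (2 * δ * ((n : ℝ) - 1)) := by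
        field_simp
        ring
      rw [this]
      positivity
    linarith
end

section
/- Let n, δ ∈ ℕ with δ ≥ 3 and n ≥ 16. If G is a connected, C₄-free graph of order n and minimum degree δ, then rad(G) − π(G) ≤ 5(n−1)/(4(δ² − 2⌊δ/2⌋ + 1)) + 4. -/
namespace SimpleGraph

variable {V : Type*} {G : SimpleGraph V}

lemma Connected.exists_adj_dist_eq_of_dist_eq_succ (hG : G.Connected) {u v : V} {k : ℕ}
    (h : G.dist u v = k + 1) : ∃ w, G.Adj w v ∧ G.dist u w = k := by
  obtain ⟨p, hp⟩ := hG.exists_walk_length_eq_dist v u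
  rw [dist_comm, h] at hp
  cases p with
  | nil => simp at hp
  | @cons _ w _ hvw q =>
    refine ⟨w, hvw.symm, ?_⟩
    have h1 : G.dist w u ≤ k := (dist_le q).trans (by simpa using hp.le)
    have h2 := hG.dist_triangle (u := u) (v := w) (w := v)
    have h3 : G.dist w v = 1 := dist_eq_one_iff_adj.mpr hvw.symm
    rw [dist_comm] at h1
    omega

/-- `f` is twice the distance to a fixed point of `G`, where the point is either a vertex or
the midpoint of an edge. -/
def IsDoubledDist (G : SimpleGraph V) (f : V → ℕ) : Prop :=
  (∃ z, ∀ x, f x = 2 * G.dist z x) ∨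
    ∃ y z, G.Adj y z ∧ ∀ x, f x = 2 * min (G.dist y x) (G.dist z x) + 1

namespace IsDoubledDist

variable {f : V → ℕ}

lemma le_add (hG : G.Connected) (hf : G.IsDoubledDist f) (x y : V) :
    f x ≤ f y + 2 * G.dist y x := by
  rcases hf with ⟨z, hz⟩ | ⟨z, w, -, hz⟩
  · have := hG.dist_triangle (u := z) (v := y) (w := x)
    rw [hz, hz]; omega
  · have := hG.dist_triangle (u := z) (v := y) (w := x)
    have := hG.dist_triangle (u := w) (v := y) (w := x)
    rw [hz, hz]; omega

lemma exists_vertex (hG : G.Connected) (hf : G.IsDoubledDist f) :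
    ∃ z, ∀ x, 2 * G.dist z x ≤ f x + 1 := by
  rcases hf with ⟨z, hz⟩ | ⟨z, w, hzw, hz⟩
  · exact ⟨z, fun x => by rw [hz]; omega⟩
  · refine ⟨z, fun x => ?_⟩
    have := hG.dist_triangle (u := z) (v := w) (w := x)
    have : G.dist z w = 1 := dist_eq_one_iff_adj.mpr hzw
    rw [hz]; omega

lemma exists_half_step (hG : G.Connected) (hf : G.IsDoubledDist f) (a : V) :
    ∃ g, G.IsDoubledDist g ∧ g a ≤ f a - 1 ∧ ∀ x, g x ≤ f x + 1 := by
  rcases hf with ⟨z, hz⟩ | ⟨z, w, hzw, hz⟩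
  · rcases h : G.dist a z with - | k
    · refine ⟨f, .inl ⟨z, hz⟩, ?_, fun x => by omega⟩
      rw [hz, dist_comm, h]
    · obtain ⟨w, hwz, hw⟩ := hG.exists_adj_dist_eq_of_dist_eq_succ h
      refine ⟨_, .inr ⟨w, z, hwz, fun x => rfl⟩, ?_, fun x => ?_⟩
      · rw [dist_comm] at h hw
        rw [hz]; omega
      · rw [hz]; omega
  · have hd : G.dist z w = 1 := dist_eq_one_iff_adj.mpr hzw
    have hd' : G.dist w z = 1 := dist_eq_one_iff_adj.mpr hzw.symm
    rcases le_total (G.dist z a) (G.dist w a) with h | h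
    · refine ⟨_, .inl ⟨z, fun x => rfl⟩, ?_, fun x => ?_⟩
      · rw [hz]; omega
      · have := hG.dist_triangle (u := z) (v := w) (w := x)
        rw [hz]; omega
    · refine ⟨_, .inl ⟨w, fun x => rfl⟩, ?_, fun x => ?_⟩
      · rw [hz]; omega
      · have := hG.dist_triangle (u := w) (v := z) (w := x)
        rw [hz]; omega

lemma exists_move (hG : G.Connected) (hf : G.IsDoubledDist f) (a : V) (k : ℕ) :
    ∃ g, G.IsDoubledDist g ∧ g a ≤ f a - k ∧ ∀ x, g x ≤ f x + k := by
  induction k with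
  | zero => exact ⟨f, hf, by simp, by simp⟩
  | succ k ih =>
    obtain ⟨g, hg, hga, hgx⟩ := ih
    obtain ⟨h, hh, hha, hhx⟩ := hg.exists_half_step hG a
    refine ⟨h, hh, by omega, fun x => ?_⟩
    have := hgx x
    have := hhx x
    omega

end IsDoubledDist

/-- Outside the ball of radius `t` around `v` there is a set of `a` vertices at pairwise distance
at least `5`, where `2 * rad G ≤ 2 * t + 5 * a + 1`. -/
lemma Connected.exists_packing [Fintype V] (hG : G.Connected) (v : V) {t : ℕ} (ht : 2 ≤ t) :
    ∃ A : Finset V, (∀ a ∈ A, t < G.dist v a) ∧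
      (∀ a ∈ A, ∀ b ∈ A, a ≠ b → 5 ≤ G.dist a b) ∧
      ∃ z, ∀ x, 2 * G.dist z x ≤ 2 * t + 5 * A.card + 1 := by
  classical
  let P : Finset V → Prop := fun A => (∀ a ∈ A, t < G.dist v a) ∧
    (∀ a ∈ A, ∀ b ∈ A, a ≠ b → 5 ≤ G.dist a b) ∧
    ∃ f, G.IsDoubledDist f ∧ (∀ x, G.dist v x ≤ t → f x ≤ 2 * t + 5 * A.card) ∧
      ∀ a ∈ A, f a + 8 ≤ 2 * t + 5 * A.card
  have hP : (Finset.univ.filter P).Nonempty := by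
    refine ⟨∅, Finset.mem_filter.mpr ⟨Finset.mem_univ _, by simp, by simp, _,
      .inl ⟨v, fun x => rfl⟩, fun x hx => ?_, by simp⟩⟩
    omega
  obtain ⟨A, hA, hmax⟩ := Finset.exists_max_image _ Finset.card hP
  obtain ⟨hAt, hA5, f, hf, hft, hfA⟩ := (Finset.mem_filter.mp hA).2
  have hcover : ∀ x, t < G.dist v x → ∃ a ∈ A, G.dist a x ≤ 4 := by
    by_contra! hcon
    obtain ⟨x₀, hx₀⟩ := hcon
    obtain ⟨x, hx, hmin⟩ := Finset.exists_min_image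
      (Finset.univ.filter fun x => t < G.dist v x ∧ ∀ a ∈ A, 4 < G.dist a x) (G.dist v)
      ⟨x₀, by simpa using hx₀⟩
    simp only [Finset.mem_filter, Finset.mem_univ, true_and] at hx hmin
    obtain ⟨hxt, hxA⟩ := hx
    have hxnot : x ∉ A := fun h => by simpa using hxA x h
    obtain ⟨y, hyx, hy⟩ := hG.exists_adj_dist_eq_of_dist_eq_succ
      (show G.dist v x = (G.dist v x - 1) + 1 by omega)
    have hyx1 : G.dist y x = 1 := dist_eq_one_iff_adj.mpr hyx
    have hfx : f x ≤ 2 * t + 5 * A.card + 2 := by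
      by_cases hyt : G.dist v y ≤ t
      · have := hf.le_add hG x y
        have := hft y hyt
        omega
      · obtain ⟨b, hb, hby⟩ : ∃ b ∈ A, G.dist b y ≤ 4 := by
          by_contra! h
          have := hmin y ⟨by omega, h⟩
          omega
        have := hG.dist_triangle (u := b) (v := y) (w := x)
        have := hf.le_add hG x b
        have := hfA b hb
        omega
    obtain ⟨g, hg, hgx, hgle⟩ := hf.exists_move hG x 5
    have hcard : (insert x A).card = A.card + 1 := Finset.card_insert_of_notMem hxnot
    have hins : P (insert x A) := by
      refine ⟨?_, ?_, g, hg, fun w hw => ?_, ?_⟩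
      · simpa [hxt] using hAt
      · intro a ha b hb hab
        rcases Finset.mem_insert.mp ha with rfl | haA <;>
          rcases Finset.mem_insert.mp hb with rfl | hbA
        · exact absurd rfl hab
        · rw [dist_comm]; exact hxA b hbA
        · exact hxA a haA
        · exact hA5 a haA b hbA hab
      · have := hgle w
        have := hft w hw
        omega
      · intro a ha
        rcases Finset.mem_insert.mp ha with rfl | ha
        · omega
        · have := hgle a
          have := hfA a ha
          omega
    have := hmax _ (Finset.mem_filter.mpr ⟨Finset.mem_univ _, hins⟩)
    omega
  obtain ⟨z, hz⟩ := hf.exists_vertex hG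
  refine ⟨A, hAt, hA5, z, fun x => (hz x).trans ?_⟩
  by_cases hx : G.dist v x ≤ t
  · have := hft x hx
    omega
  · obtain ⟨a, ha, hax⟩ := hcover x (by omega)
    have := hf.le_add hG x a
    have := hfA a ha
    omega

lemma even_sum_card_neighborFinset_inter [Fintype V] [DecidableEq V] [DecidableRel G.Adj]
    (S : Finset V) : Even (∑ u ∈ S, (G.neighborFinset u ∩ S).card) := by
  let H : SimpleGraph V :=
    { Adj := fun a b => G.Adj a b ∧ a ∈ S ∧ b ∈ S
      symm := ⟨fun _ _ h => ⟨h.1.symm, h.2.2, h.2.1⟩⟩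
      loopless := ⟨fun _ h => G.irrefl h.1⟩ }
  have hdec : DecidableRel H.Adj := Classical.decRel _
  have hdeg : ∀ u, H.degree u = if u ∈ S then (G.neighborFinset u ∩ S).card else 0 := by
    intro u
    rw [← card_neighborFinset_eq_degree]
    split_ifs with hu
    · congr 1
      ext w
      simp [H, hu]
    · rw [Finset.card_eq_zero]
      ext w
      simp [H, hu]
  have hsum := H.sum_degrees_eq_twice_card_edges
  simp only [hdeg, Finset.sum_ite_mem, Finset.univ_inter] at hsum
  exact hsum ▸ even_two_mul _

/-- A ball of radius two in a `C₄`-free graph of minimum degree `δ` has at least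
`δ² - 2⌊δ/2⌋ + 1` vertices. -/
lemma Connected.le_card_ball_two [Fintype V] [DecidableEq V] [DecidableRel G.Adj]
    (hG : G.Connected) {δ : ℕ} (hδ : ∀ u, δ ≤ G.degree u) (h2 : 2 ≤ δ)
    (hc4 : ∀ a b c d : V, G.Adj a b → G.Adj b c → G.Adj c d → G.Adj d a → a ≠ c → b ≠ d → False)
    (v : V) :
    δ ^ 2 - 2 * (δ / 2) + 1 ≤ (Finset.univ.filter fun w => G.dist v w ≤ 2).card := by
  set N := G.neighborFinset v with hN
  have hvN : v ∉ N := by simp [hN]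
  set E : V → Finset V := fun u => G.neighborFinset u \ insert v N with hE
  have hdisj : (N : Set V).PairwiseDisjoint E := by
    intro a ha b hb hab
    refine Finset.disjoint_left.mpr fun w hwa hwb => ?_
    simp only [hE, hN, Finset.mem_sdiff, mem_neighborFinset, Finset.mem_insert, not_or,
      Finset.mem_coe] at hwa hwb ha hb
    exact hc4 v a w b ha hwa.1 hwb.1.symm hb.symm (Ne.symm hwa.2.1) hab
  have hsub : insert v N ∪ N.biUnion E ⊆ Finset.univ.filter fun w => G.dist v w ≤ 2 := by
    intro w hw
    simp only [Finset.mem_union, Finset.mem_insert, Finset.mem_biUnion, hE, hN,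
      mem_neighborFinset, Finset.mem_sdiff] at hw
    simp only [Finset.mem_filter, Finset.mem_univ, true_and]
    rcases hw with (rfl | hw) | ⟨u, hu, hw, -⟩
    · simp
    · rw [dist_eq_one_iff_adj.mpr hw]; omega
    · have := hG.dist_triangle (u := v) (v := u) (w := w)
      rw [dist_eq_one_iff_adj.mpr hu, dist_eq_one_iff_adj.mpr hw] at this
      omega
  have hdisj' : Disjoint (insert v N) (N.biUnion E) := by
    refine (Finset.disjoint_biUnion_right _ _ _).mpr fun u _ => Finset.disjoint_sdiff
  have hcard := Finset.card_le_card hsub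
  rw [Finset.card_union_of_disjoint hdisj', Finset.card_insert_of_notMem hvN,
    Finset.card_biUnion hdisj] at hcard
  have hEu : ∀ u ∈ N, δ ≤ (E u).card + ((G.neighborFinset u ∩ N).card + 1) := by
    intro u hu
    have h1 := Finset.card_sdiff_add_card_inter (G.neighborFinset u) (insert v N)
    have hvu : v ∈ G.neighborFinset u := by
      simpa [hN, adj_comm] using hu
    rw [Finset.inter_insert_of_mem hvu,
      Finset.card_insert_of_notMem (fun h => hvN (Finset.mem_inter.mp h).2),
      card_neighborFinset_eq_degree] at h1
    exact (hδ u).trans h1.ge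
  have hsum := Finset.sum_le_sum hEu
  rw [Finset.sum_add_distrib, Finset.sum_add_distrib] at hsum
  simp only [Finset.sum_const, smul_eq_mul, mul_one] at hsum
  have hM1 : ∑ u ∈ N, (G.neighborFinset u ∩ N).card ≤ N.card := by
    refine (Finset.sum_le_card_nsmul _ _ 1 fun u hu => Finset.card_le_one.mpr ?_).trans (by simp)
    intro a ha b hb
    by_contra hab
    simp only [hN, Finset.mem_inter, mem_neighborFinset] at ha hb hu
    exact hc4 v a u b ha.2 ha.1.symm hb.1 hb.2.symm hu.ne hab
  obtain ⟨m, hm⟩ := G.even_sum_card_neighborFinset_inter N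
  have hd : δ ≤ N.card := by simpa [hN] using hδ v
  obtain ⟨k, hk⟩ := Nat.exists_eq_add_of_le hd
  have hmul : N.card * δ = δ ^ 2 + k * δ := by rw [hk]; ring
  have hk2 : k * 2 ≤ k * δ := Nat.mul_le_mul_left k h2
  omega

/-- If all balls of radius two have at least `D` vertices, then there are at least
`D * (2 * (r - s) - 3) / 5` vertices at distance at least `s` from `v`, where `r` is the
radius. -/
lemma Connected.mul_le_card_dist_ge [Fintype V] (hG : G.Connected) {D r : ℕ}
    (hD : ∀ u, D ≤ (Finset.univ.filter fun w => G.dist u w ≤ 2).card)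
    (hr : ∀ z, ∃ x, r ≤ G.dist z x) (v : V) {s : ℕ} (hs : 1 ≤ s) :
    D * (2 * (r - s) - 3) ≤ 5 * (Finset.univ.filter fun w => s ≤ G.dist v w).card := by
  classical
  obtain ⟨A, hAt, hA5, z, hz⟩ := hG.exists_packing v (show 2 ≤ s + 1 by omega)
  obtain ⟨x, hx⟩ := hr z
  have hzx := hz x
  have hdisj : (A : Set V).PairwiseDisjoint
      fun a => Finset.univ.filter fun w => G.dist a w ≤ 2 := by
    intro a ha b hb hab
    refine Finset.disjoint_left.mpr fun w hwa hwb => ?_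
    simp only [Finset.mem_filter, Finset.mem_univ, true_and] at hwa hwb
    have := hG.dist_triangle (u := a) (v := w) (w := b)
    have := hA5 a ha b hb hab
    rw [dist_comm] at hwb
    omega
  have hsub : (A.biUnion fun a => Finset.univ.filter fun w => G.dist a w ≤ 2) ⊆
      Finset.univ.filter fun w => s ≤ G.dist v w := by
    intro w hw
    simp only [Finset.mem_biUnion, Finset.mem_filter, Finset.mem_univ, true_and] at hw ⊢
    obtain ⟨a, ha, haw⟩ := hw
    have := hG.dist_triangle (u := v) (v := w) (w := a)
    have := hAt a ha
    rw [dist_comm] at haw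
    omega
  have hcard := Finset.card_le_card hsub
  rw [Finset.card_biUnion hdisj] at hcard
  have hsum := Finset.card_nsmul_le_sum A _ D fun a _ => hD a
  rw [smul_eq_mul] at hsum
  calc D * (2 * (r - s) - 3) ≤ D * (5 * A.card) := Nat.mul_le_mul_left _ (by omega)
    _ = 5 * (A.card * D) := by ring
    _ ≤ _ := Nat.mul_le_mul_left _ (hsum.trans hcard)

lemma Connected.mul_sq_le_sum_dist [Fintype V] (hG : G.Connected) {D k : ℕ}
    (hD : ∀ u, D ≤ (Finset.univ.filter fun w => G.dist u w ≤ 2).card)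
    (hr : ∀ z, ∃ x, k + 2 ≤ G.dist z x) (v : V) :
    D * k ^ 2 ≤ 5 * ∑ w, G.dist v w := by
  have hodd : ∑ i ∈ Finset.range k, (2 * (k - 1 - i) + 1) = k ^ 2 := by
    rw [Finset.sum_range_reflect (fun i => 2 * i + 1) k]
    induction k with
    | zero => simp
    | succ k ih =>
      rw [Finset.sum_range_succ, ih fun z => (hr z).imp fun x hx => by omega]
      ring
  have hlayer : ∑ i ∈ Finset.range k, (Finset.univ.filter fun w => i + 1 ≤ G.dist v w).card ≤
      ∑ w, G.dist v w := by
    simp only [Finset.card_filter]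
    rw [Finset.sum_comm]
    refine Finset.sum_le_sum fun w _ => ?_
    rw [← Finset.card_filter]
    refine (Finset.card_le_card (t := Finset.range (G.dist v w)) fun i hi => ?_).trans
      (Finset.card_range _).le
    simp only [Finset.mem_filter] at hi
    exact Finset.mem_range.mpr hi.2
  refine le_trans ?_ (Nat.mul_le_mul_left 5 hlayer)
  rw [← hodd, Finset.mul_sum, Finset.mul_sum]
  refine Finset.sum_le_sum fun i hi => ?_
  have hi := Finset.mem_range.mp hi
  refine le_trans (Nat.mul_le_mul_left D ?_)
    (hG.mul_le_card_dist_ge hD hr v (show 1 ≤ i + 1 by omega))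
  omega

end SimpleGraph

theorem stmt18 {V : Type*} [Fintype V] [DecidableEq V] (G : SimpleGraph V)
    [DecidableRel G.Adj] (n δ : ℕ) (hn : Fintype.card V = n) (hδ : G.minDegree = δ) (hconn : G.Connected) (h3 : 3 ≤ δ) (h16 : 16 ≤ n) (hc4 : (∀ a b c d : V, G.Adj a b → G.Adj b c → G.Adj c d → G.Adj d a → a ≠ c → b ≠ d → False)) :
    (((⨅ v : V, Finset.univ.sup fun w : V => G.dist v w) : ℕ) : ℝ) - (⨅ v : V, (∑ w : V, (G.dist v w : ℝ)) / ((n : ℝ) - 1)) ≤ 5 * ((n : ℝ) - 1) / (4 * ((δ ^ 2 - 2 * (δ / 2) + 1 : ℕ) : ℝ)) + 4 := by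
  have : Nonempty V := hconn.nonempty
  have hn1 : (0 : ℝ) < (n : ℝ) - 1 := by
    have : (16 : ℝ) ≤ n := by exact_mod_cast h16
    linarith
  set r : ℕ := ⨅ v : V, Finset.univ.sup fun w : V => G.dist v w with hr
  set D : ℕ := δ ^ 2 - 2 * (δ / 2) + 1 with hD
  have hDpos : (0 : ℝ) < D := by exact_mod_cast Nat.succ_pos _
  obtain ⟨v, hv⟩ := exists_eq_ciInf_of_finite
    (f := fun v : V => (∑ w : V, (G.dist v w : ℝ)) / ((n : ℝ) - 1))
  rw [← hv]
  have hball := fun u => hconn.le_card_ball_two (fun u => hδ ▸ G.minDegree_le_degree u)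
    (show 2 ≤ δ by omega) hc4 u
  have hfar : ∀ z, ∃ x, r ≤ G.dist z x := by
    intro z
    obtain ⟨x, -, hx⟩ := Finset.exists_mem_eq_sup Finset.univ Finset.univ_nonempty (G.dist z)
    exact ⟨x, hx ▸ ciInf_le (OrderBot.bddBelow _) z⟩
  have hS : (0 : ℝ) ≤ ∑ w : V, (G.dist v w : ℝ) := by positivity
  rcases lt_or_ge r 2 with hlt | hge
  · have h1 : (r : ℝ) ≤ 4 := by exact_mod_cast (show r ≤ 4 by omega)
    have h2 : 0 ≤ (∑ w : V, (G.dist v w : ℝ)) / ((n : ℝ) - 1) := by positivity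
    have h3 : 0 ≤ 5 * ((n : ℝ) - 1) / (4 * (D : ℝ)) := by positivity
    linarith
  · obtain ⟨k, hk⟩ := Nat.exists_eq_add_of_le' hge
    rw [hk] at hfar ⊢
    have hsum : (D : ℝ) * (k : ℝ) ^ 2 ≤ 5 * ∑ w : V, (G.dist v w : ℝ) := by
      exact_mod_cast hconn.mul_sq_le_sum_dist hball hfar v
    have hdiv : (D : ℝ) * (k : ℝ) ^ 2 / (5 * ((n : ℝ) - 1)) ≤
        (∑ w : V, (G.dist v w : ℝ)) / ((n : ℝ) - 1) := by
      rw [div_le_div_iff₀ (by positivity) hn1]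
      nlinarith
    have hamgm : (k : ℝ) ≤ 5 * ((n : ℝ) - 1) / (4 * (D : ℝ)) +
        (D : ℝ) * (k : ℝ) ^ 2 / (5 * ((n : ℝ) - 1)) := by
      rw [div_add_div _ _ (by positivity) (by positivity), le_div_iff₀ (by positivity)]
      nlinarith [sq_nonneg (5 * ((n : ℝ) - 1) - 2 * (D : ℝ) * k)]
    push_cast
    linarith
end
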